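/- Fix an integer p ≥ 3 and let λ = 2cos(π/p). Let α be a G_p-simple number: a hyperbolic fixed point of the Hecke group G_p with Hecke conjugate α' < 0 < α. Then the forward orbit {α, Φ_p(α), Φ_p²(α), …} of α under the map Φ_p is finite, Φ_p permutes it cyclically, and this orbit consists exactly of all G_p-simple numbers that are G_p-equivalent to α (i.e. of the form Vα for some V ∈ G_p). -/

import Mathlib

open Real Matrix Filter

noncomputable section

/-- `λ_p = 2 cos (π / p)`, the minimal translation length of the Hecke group `G_p`. -/
def heckeLambda (p : ℕ) : ℝ := 2 * Real.cos (Real.pi / p)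

/-- The matrix `S = [[1, λ], [0, 1]]`. -/
def Smat (l : ℝ) : Matrix (Fin 2) (Fin 2) ℝ := !![1, l; 0, 1]

/-- The matrix `T = [[0, -1], [1, 0]]`. -/
def Tmat : Matrix (Fin 2) (Fin 2) ℝ := !![0, -1; 1, 0]

/-- The matrix `U = S * T = [[λ, -1], [1, 0]]`. -/
def Umat (l : ℝ) : Matrix (Fin 2) (Fin 2) ℝ := !![l, -1; 1, 0]

/-- The matrix `S^r = [[1, rλ], [0, 1]]` for an integer exponent `r`. -/
def SmatZ (l : ℝ) (r : ℤ) : Matrix (Fin 2) (Fin 2) ℝ := !![1, (r : ℝ) * l; 0, 1]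

/-- Möbius (linear fractional) action of a `2 × 2` real matrix on a real number. -/
def mobius (M : Matrix (Fin 2) (Fin 2) ℝ) (x : ℝ) : ℝ :=
  (M 0 0 * x + M 0 1) / (M 1 0 * x + M 1 1)

/-- `U^k(0)`, the image of `0` under `k` iterations of the linear fractional
transformation `U : x ↦ λ - 1/x`; as a ratio of entries of the matrix power `U^k`. -/
def Uorbit (l : ℝ) (k : ℕ) : ℝ := ((Umat l) ^ k) 0 1 / ((Umat l) ^ k) 1 1

/-- The complete quotients `α_j` of the (negative) `λ`-continued fraction algorithm:
`α_0 = α`, `α_{j+1} = 1 / (r_j λ - α_j)` with `r_j = ⌊α_j / λ⌋ + 1`. -/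
def cq (l α : ℝ) : ℕ → ℝ
  | 0 => α
  | j + 1 => 1 / (((⌊cq l α j / l⌋ : ℝ) + 1) * l - cq l α j)

/-- The partial quotients `r_j = ⌊α_j / λ⌋ + 1` of the `λ`-continued fraction of `α`. -/
def pq (l α : ℝ) (j : ℕ) : ℤ := ⌊cq l α j / l⌋ + 1

/-- `S` as an element of `SL(2, ℝ)`. -/
def Sgen (l : ℝ) : Matrix.SpecialLinearGroup (Fin 2) ℝ :=
  ⟨!![1, l; 0, 1], by norm_num [Matrix.det_fin_two_of]⟩

/-- `T` as an element of `SL(2, ℝ)`. -/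
def Tgen : Matrix.SpecialLinearGroup (Fin 2) ℝ :=
  ⟨!![0, -1; 1, 0], by norm_num [Matrix.det_fin_two_of]⟩

/-- The Hecke group `G_p`, the subgroup of `SL(2, ℝ)` generated by `S` and `T`. -/
def heckeGroup (l : ℝ) : Subgroup (Matrix.SpecialLinearGroup (Fin 2) ℝ) :=
  Subgroup.closure {Sgen l, Tgen}

/-- `M = [[a, b], [c, d]]` fixes `α` as a linear fractional transformation, i.e.
`α` is a root of `c x² + (d - a) x - b = 0`. -/
def fixesQuad (M : Matrix.SpecialLinearGroup (Fin 2) ℝ) (α : ℝ) : Prop :=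
  M.1 1 0 * α ^ 2 + (M.1 1 1 - M.1 0 0) * α - M.1 0 1 = 0

/-- `α` is a hyperbolic fixed point of the Hecke group `G(λ)`. -/
def IsHypFixedPt (l α : ℝ) : Prop :=
  ∃ M ∈ heckeGroup l, 2 < |M.1 0 0 + M.1 1 1| ∧ fixesQuad M α

/-- `α` is a hyperbolic fixed point of `G(λ)` with Hecke conjugate `α'`
(the other root of the fixed-point quadratic). -/
def IsHypPair (l α α' : ℝ) : Prop :=
  ∃ M ∈ heckeGroup l, 2 < |M.1 0 0 + M.1 1 1| ∧ fixesQuad M α ∧ fixesQuad M α' ∧ α' ≠ α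

/-- A hyperbolic fixed point is `G_p`-reduced when its complete-quotient sequence is
purely periodic. -/
def GpReduced (l β : ℝ) : Prop :=
  IsHypFixedPt l β ∧ ∃ m, 1 ≤ m ∧ cq l β m = β

/-- The map `Φ_p : [0, ∞) → [0, ∞)`: `Φ_p(x) = T U^i (x)` when
`U^{p-i+1}(0) ≤ x < U^{p-i}(0)` for the (unique) `i` with `1 ≤ i ≤ p - 2`,
and `Φ_p(x) = x - λ` when `x ≥ λ`. -/
def Phi (p : ℕ) (l : ℝ) (x : ℝ) : ℝ :=
  @dite ℝ (∃ i : ℕ, 1 ≤ i ∧ i ≤ p - 2 ∧ Uorbit l (p - i + 1) ≤ x ∧ x < Uorbit l (p - i))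
    (Classical.propDecidable _)
    (fun h => mobius (Tmat * (Umat l) ^ h.choose) x)
    (fun _ => x - l)

/-- `C_{n-j, n}`: the partial convergents computed by downward recursion,
`C_{n,n} = r_n λ` and `C_{m,n} = r_m λ - 1 / C_{m+1,n}`. -/
def convAux (l α : ℝ) (n : ℕ) : ℕ → ℝ
  | 0 => (pq l α n : ℝ) * l
  | j + 1 => (pq l α (n - (j + 1)) : ℝ) * l - 1 / convAux l α n j

/-- The `n`-th convergent `C_n = C_{0,n}` of the `λ`-continued fraction of `α`. -/
def conv (l α : ℝ) (n : ℕ) : ℝ := convAux l α n n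

/-- The word `S^{r_0} T S^{r_1} T ⋯ S^{r_n} T`. -/
def cfWord (l : ℝ) (r : ℕ → ℤ) (n : ℕ) : Matrix (Fin 2) (Fin 2) ℝ :=
  ((List.range (n + 1)).map fun j => SmatZ l (r j) * Tmat).prod

/-- The normalised sine `sin (x π / p) / sin (π / p)`. -/
def sinRatio (p : ℕ) (x : ℝ) : ℝ := Real.sin (x * (Real.pi / p)) / Real.sin (Real.pi / p)

theorem sin_pi_div_pos {p : ℕ} (hp : 3 ≤ p) : 0 < Real.sin (Real.pi / p) := by
  have h3 : (3 : ℝ) ≤ p := by exact_mod_cast hp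
  apply Real.sin_pos_of_pos_of_lt_pi
  · exact div_pos Real.pi_pos (by linarith)
  · exact div_lt_self Real.pi_pos (by linarith)

theorem sinRatio_zero (p : ℕ) : sinRatio p 0 = 0 := by simp [sinRatio]

theorem sinRatio_one {p : ℕ} (hp : 3 ≤ p) : sinRatio p 1 = 1 := by
  simp [sinRatio, (sin_pi_div_pos hp).ne']

theorem sinRatio_two {p : ℕ} (hp : 3 ≤ p) : sinRatio p 2 = heckeLambda p := by
  have := (sin_pi_div_pos hp).ne'
  rw [sinRatio, Real.sin_two_mul, heckeLambda]
  field_simp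

theorem sinRatio_neg (p : ℕ) (x : ℝ) : sinRatio p (-x) = -sinRatio p x := by
  simp [sinRatio, neg_div]

theorem sinRatio_sub {p : ℕ} (hp : 3 ≤ p) (x : ℝ) : sinRatio p (p - x) = sinRatio p x := by
  have h3 : (p : ℝ) ≠ 0 := by positivity
  have : ((p : ℝ) - x) * (Real.pi / p) = Real.pi - x * (Real.pi / p) := by field_simp
  rw [sinRatio, this, Real.sin_pi_sub, sinRatio]

theorem sinRatio_self {p : ℕ} (hp : 3 ≤ p) : sinRatio p p = 0 := by
  have := sinRatio_sub hp 0
  rwa [sub_zero, sinRatio_zero] at this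

theorem sinRatio_add_one (p : ℕ) (x : ℝ) :
    sinRatio p (x + 1) = heckeLambda p * sinRatio p x - sinRatio p (x - 1) := by
  simp only [sinRatio, heckeLambda, add_mul, sub_mul, one_mul, Real.sin_add, Real.sin_sub]
  ring

theorem sinRatio_sq {p : ℕ} (hp : 3 ≤ p) (x : ℝ) :
    sinRatio p x ^ 2 - sinRatio p (x - 1) * sinRatio p (x + 1) = 1 := by
  have h := (sin_pi_div_pos hp).ne'
  simp only [sinRatio, add_mul, sub_mul, one_mul, Real.sin_add, Real.sin_sub]
  have h1 := Real.sin_sq_add_cos_sq (x * (Real.pi / p))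
  have h2 := Real.sin_sq_add_cos_sq (Real.pi / p)
  generalize x * (Real.pi / p) = y at *
  field_simp
  linear_combination
    Real.sin (Real.pi / p) ^ 2 * h1 - Real.sin y ^ 2 * h2

theorem sinRatio_nonneg {p : ℕ} (hp : 3 ≤ p) {x : ℝ} (h0 : 0 ≤ x) (h1 : x ≤ p) :
    0 ≤ sinRatio p x := by
  have h3 : (0 : ℝ) < p := by positivity
  refine div_nonneg (Real.sin_nonneg_of_nonneg_of_le_pi (by positivity) ?_) (sin_pi_div_pos hp).le
  calc x * (Real.pi / p) ≤ p * (Real.pi / p) := by gcongr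
    _ = Real.pi := by field_simp

theorem one_le_sinRatio {p : ℕ} (hp : 3 ≤ p) {x : ℝ} (h0 : 1 ≤ x) (h1 : x + 1 ≤ p) :
    1 ≤ sinRatio p x := by
  have h3 : (0 : ℝ) < p := by positivity
  rw [sinRatio, one_le_div (sin_pi_div_pos hp), ← sub_nonneg, Real.sin_sub_sin]
  set θ := Real.pi / p with hθ
  have hpos : 0 < θ := by positivity
  have hle : (x + 1) * θ ≤ Real.pi := by
    calc (x + 1) * θ ≤ p * θ := by gcongr
      _ = Real.pi := by rw [hθ]; field_simp
  have hx : 0 ≤ (x - 1) * θ := mul_nonneg (by linarith) hpos.le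
  refine mul_nonneg (mul_nonneg zero_le_two ?_) ?_
  · apply Real.sin_nonneg_of_nonneg_of_le_pi <;> nlinarith
  · apply Real.cos_nonneg_of_neg_pi_div_two_le_of_le <;> nlinarith [Real.pi_pos]

theorem Umat_pow {p : ℕ} (hp : 3 ≤ p) (k : ℕ) :
    Umat (heckeLambda p) ^ k =
      !![sinRatio p (k + 1), -sinRatio p k; sinRatio p k, -sinRatio p (k - 1)] := by
  induction k with
  | zero =>
    simp [sinRatio_zero, sinRatio_one hp, sinRatio_neg, Matrix.one_fin_two]
  | succ k ih =>
    rw [pow_succ', ih, Umat]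
    have h1 := sinRatio_add_one p (k + 1)
    have h2 := sinRatio_add_one p k
    rw [add_sub_cancel_right] at h1
    ext i j
    fin_cases i <;> fin_cases j <;>
      simp [Matrix.mul_apply, Fin.sum_univ_two] <;> linarith

/-- The product `U = S T` in `SL(2, ℝ)`. -/
def Ugen (l : ℝ) : Matrix.SpecialLinearGroup (Fin 2) ℝ := Sgen l * Tgen

theorem coe_Ugen (l : ℝ) : (Ugen l).1 = Umat l := by
  ext i j
  rw [Ugen, Matrix.SpecialLinearGroup.coe_mul]
  fin_cases i <;> fin_cases j <;> simp [Sgen, Tgen, Umat]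

theorem coe_Ugen_pow (l : ℝ) (k : ℕ) : (Ugen l ^ k).1 = Umat l ^ k := by
  rw [← coe_Ugen]; exact Matrix.SpecialLinearGroup.coe_pow _ _

theorem Tgen_sq : Tgen ^ 2 = -1 := by
  ext i j
  rw [sq, Matrix.SpecialLinearGroup.coe_mul]
  fin_cases i <;> fin_cases j <;> simp [Tgen]

theorem Ugen_pow_self {p : ℕ} (hp : 3 ≤ p) : Ugen (heckeLambda p) ^ p = -1 := by
  have h1 : sinRatio p ((p : ℝ) - 1) = 1 := by rw [sinRatio_sub hp, sinRatio_one hp]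
  have h2 : sinRatio p ((p : ℝ) + 1) = -1 := by
    have := sinRatio_sub hp (-1)
    rwa [sinRatio_neg, sinRatio_one hp, sub_neg_eq_add] at this
  apply Subtype.ext
  rw [coe_Ugen_pow, Umat_pow hp, sinRatio_self hp, h1, h2]
  ext i j
  fin_cases i <;> fin_cases j <;> simp

/-- The matrix `U⁻ⁱ T`, inverse up to sign of the `i`-th branch `T Uⁱ` of `Φ_p`. -/
def branchInv (p i : ℕ) : Matrix.SpecialLinearGroup (Fin 2) ℝ :=
  (Ugen (heckeLambda p) ^ i)⁻¹ * Tgen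

theorem coe_branchInv {p : ℕ} (hp : 3 ≤ p) (i : ℕ) :
    (branchInv p i).1 =
      !![sinRatio p i, sinRatio p (i - 1); sinRatio p (i + 1), sinRatio p i] := by
  have h : ((Ugen (heckeLambda p) ^ i)⁻¹).1 =
      !![-sinRatio p (i - 1), sinRatio p i; -sinRatio p i, sinRatio p (i + 1)] := by
    rw [Matrix.SpecialLinearGroup.coe_inv, coe_Ugen_pow, Umat_pow hp, Matrix.adjugate_fin_two_of]
    simp
  have h' : (branchInv p i).1 = ((Ugen (heckeLambda p) ^ i)⁻¹).1 * Tgen.1 := rfl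
  rw [h', h]
  ext a b
  fin_cases a <;> fin_cases b <;> simp [Tgen, Matrix.mul_apply, Fin.sum_univ_two]

/-- The monoid generated by the matrices `U⁻ⁱ T` with `1 ≤ i ≤ p - 1`. -/
def branchMonoid (p : ℕ) : Submonoid (Matrix.SpecialLinearGroup (Fin 2) ℝ) :=
  Submonoid.closure {g | ∃ i, 1 ≤ i ∧ i < p ∧ g = branchInv p i}

theorem branchInv_mem {p i : ℕ} (h1 : 1 ≤ i) (h2 : i < p) : branchInv p i ∈ branchMonoid p :=
  Submonoid.subset_closure ⟨i, h1, h2, rfl⟩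

theorem eq_one_or_branchInv_mul {p : ℕ} {w : Matrix.SpecialLinearGroup (Fin 2) ℝ}
    (hw : w ∈ branchMonoid p) :
    w = 1 ∨ ∃ i, 1 ≤ i ∧ i < p ∧ ∃ v ∈ branchMonoid p, w = branchInv p i * v := by
  induction hw using Submonoid.closure_induction_left with
  | one => exact Or.inl rfl
  | mul_left x hx y hy _ =>
    obtain ⟨i, h1, h2, rfl⟩ := hx
    exact Or.inr ⟨i, h1, h2, y, hy, rfl⟩

theorem Tgen_mem (l : ℝ) : Tgen ∈ heckeGroup l := Subgroup.subset_closure (by simp)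

theorem Ugen_mem (l : ℝ) : Ugen l ∈ heckeGroup l :=
  mul_mem (Subgroup.subset_closure (by simp)) (Tgen_mem l)

theorem branchMonoid_le {p : ℕ} : branchMonoid p ≤ (heckeGroup (heckeLambda p)).toSubmonoid := by
  rw [branchMonoid, Submonoid.closure_le]
  rintro _ ⟨i, -, -, rfl⟩
  exact Subgroup.mul_mem _ (inv_mem (pow_mem (Ugen_mem _) i)) (Tgen_mem _)

theorem entries_of_mem_branchMonoid {p : ℕ} (hp : 3 ≤ p)
    {w : Matrix.SpecialLinearGroup (Fin 2) ℝ} (hw : w ∈ branchMonoid p) :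
    1 ≤ w.1 0 0 ∧ 0 ≤ w.1 0 1 ∧ 0 ≤ w.1 1 0 ∧ 1 ≤ w.1 1 1 := by
  induction hw using Submonoid.closure_induction with
  | mem x hx =>
    obtain ⟨i, h1, h2, rfl⟩ := hx
    have h1' : (1 : ℝ) ≤ i := by exact_mod_cast h1
    have h2' : (i : ℝ) + 1 ≤ p := by exact_mod_cast h2
    rw [coe_branchInv hp]
    exact ⟨one_le_sinRatio hp h1' h2', sinRatio_nonneg hp (by linarith) (by linarith),
      sinRatio_nonneg hp (by linarith) h2', one_le_sinRatio hp h1' h2'⟩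
  | one => simp
  | mul x y _ _ hx hy =>
    obtain ⟨a1, b1, c1, d1⟩ := hx
    obtain ⟨a2, b2, c2, d2⟩ := hy
    simp only [Matrix.SpecialLinearGroup.coe_mul, Matrix.mul_apply, Fin.sum_univ_two]
    refine ⟨?_, ?_, ?_, ?_⟩
    · nlinarith [mul_nonneg b1 c2]
    · nlinarith [mul_nonneg b1 (zero_le_one.trans d2), mul_nonneg (zero_le_one.trans a1) b2]
    · nlinarith [mul_nonneg c1 (zero_le_one.trans a2), mul_nonneg (zero_le_one.trans d1) c2]
    · nlinarith [mul_nonneg c1 b2]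

theorem exists_conj_Tgen {p : ℕ} (hp : 3 ≤ p) {w : Matrix.SpecialLinearGroup (Fin 2) ℝ}
    (hw : w ∈ branchMonoid p) : ∃ v ∈ branchMonoid p, Tgen * w * Tgen⁻¹ = v⁻¹ := by
  induction hw using Submonoid.closure_induction with
  | mem x hx =>
    obtain ⟨i, h1, h2, rfl⟩ := hx
    refine ⟨branchInv p (p - i), branchInv_mem (by omega) (by omega), ?_⟩
    have hU : Ugen (heckeLambda p) ^ (p - i) = -(Ugen (heckeLambda p) ^ i)⁻¹ := by
      rw [pow_sub _ h2.le, Ugen_pow_self hp, neg_one_mul]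
    have hT : Tgen⁻¹ = -Tgen := by
      rw [inv_eq_iff_mul_eq_one, mul_neg, ← sq, Tgen_sq, neg_neg]
    simp only [branchInv, hU, _root_.mul_inv_rev, _root_.inv_neg, inv_inv, hT]
    have : Tgen * Tgen = -1 := by rw [← sq, Tgen_sq]
    simp only [mul_neg, neg_mul, mul_assoc, this, mul_one, neg_neg]
  | one => exact ⟨1, one_mem _, by simp⟩
  | mul x y _ _ hx hy =>
    obtain ⟨u, hu, hxu⟩ := hx
    obtain ⟨v, hv, hyv⟩ := hy
    refine ⟨v * u, mul_mem hv hu, ?_⟩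
    rw [_root_.mul_inv_rev, ← hxu, ← hyv]
    group

/-- Elements of the form `Tᵃ w Tᵇ` with `w` in the branch monoid. -/
def HasBranchForm (p : ℕ) (g : Matrix.SpecialLinearGroup (Fin 2) ℝ) : Prop :=
  ∃ w ∈ branchMonoid p, ∃ a b : ℕ, g = Tgen ^ a * w * Tgen ^ b

theorem HasBranchForm.Tgen_pow_mul {p : ℕ} {g : Matrix.SpecialLinearGroup (Fin 2) ℝ}
    (hg : HasBranchForm p g) (n : ℕ) : HasBranchForm p (Tgen ^ n * g) := by
  obtain ⟨w, hw, a, b, rfl⟩ := hg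
  exact ⟨w, hw, n + a, b, by rw [pow_add]; group⟩

theorem Tgen_pow_even_comm (k : ℕ) (g : Matrix.SpecialLinearGroup (Fin 2) ℝ) :
    g * Tgen ^ (2 * k) = Tgen ^ (2 * k) * g := by
  rw [pow_mul, Tgen_sq]
  exact ((Commute.neg_one_right g).pow_right k).eq

theorem Ugen_eq {p : ℕ} (hp : 3 ≤ p) : Ugen (heckeLambda p) = branchInv p (p - 1) * Tgen := by
  rw [branchInv, mul_assoc, ← sq, Tgen_sq, ← Ugen_pow_self hp, eq_inv_mul_iff_mul_eq,
    ← pow_succ, Nat.sub_add_cancel (by omega)]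

theorem HasBranchForm.Ugen_mul {p : ℕ} (hp : 3 ≤ p) {g : Matrix.SpecialLinearGroup (Fin 2) ℝ}
    (hg : HasBranchForm p g) : HasBranchForm p (Ugen (heckeLambda p) * g) := by
  obtain ⟨w, hw, a, b, rfl⟩ := hg
  have hlast := branchInv_mem (p := p) (i := p - 1) (by omega) (by omega)
  obtain ⟨k, rfl | rfl⟩ := Nat.even_or_odd' a
  · have key : Ugen (heckeLambda p) * (Tgen ^ (2 * k) * w * Tgen ^ b) =
        Tgen ^ (2 * k) * (Ugen (heckeLambda p) * w * Tgen ^ b) := by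
      rw [← mul_assoc, ← mul_assoc, Tgen_pow_even_comm]; simp only [mul_assoc]
    rw [key]
    apply HasBranchForm.Tgen_pow_mul
    obtain rfl | ⟨j, h1, h2, v, hv, rfl⟩ := eq_one_or_branchInv_mul hw
    · exact ⟨_, hlast, 0, b + 1, by rw [Ugen_eq hp, pow_succ']; group⟩
    · obtain rfl | hj := h1.eq_or_lt
      · exact ⟨v, hv, 1, b, by rw [branchInv]; group⟩
      · refine ⟨branchInv p (j - 1) * v, mul_mem (branchInv_mem (by omega) (by omega)) hv, 0, b, ?_⟩
        obtain ⟨m, rfl⟩ := Nat.exists_eq_add_of_lt hj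
        have : 1 + m + 1 - 1 = m + 1 := by omega
        rw [this, branchInv, branchInv, show 1 + m + 1 = (m + 1) + 1 by ring,
          pow_succ _ (m + 1), _root_.mul_inv_rev]
        group
  · have key : Ugen (heckeLambda p) * (Tgen ^ (2 * k + 1) * w * Tgen ^ b) =
        Tgen ^ (2 * k + 2) * (branchInv p (p - 1) * w * Tgen ^ b) := by
      have hUT : Ugen (heckeLambda p) * Tgen = Tgen ^ 2 * branchInv p (p - 1) := by
        rw [Ugen_eq hp, mul_assoc, ← sq]
        exact Tgen_pow_even_comm 1 _
      calc Ugen (heckeLambda p) * (Tgen ^ (2 * k + 1) * w * Tgen ^ b)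
          = Ugen (heckeLambda p) * Tgen ^ (2 * k) * (Tgen * w * Tgen ^ b) := by
            rw [pow_succ]; simp only [mul_assoc]
        _ = Tgen ^ (2 * k) * (Ugen (heckeLambda p) * Tgen) * (w * Tgen ^ b) := by
            rw [Tgen_pow_even_comm]; simp only [mul_assoc]
        _ = _ := by rw [hUT, pow_add]; simp only [mul_assoc]
    rw [key]
    apply HasBranchForm.Tgen_pow_mul
    exact ⟨_, mul_mem hlast hw, 0, b, by simp⟩

theorem HasBranchForm.Ugen_pow_mul {p : ℕ} (hp : 3 ≤ p)
    {g : Matrix.SpecialLinearGroup (Fin 2) ℝ} (hg : HasBranchForm p g) (n : ℕ) :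
    HasBranchForm p (Ugen (heckeLambda p) ^ n * g) := by
  induction n with
  | zero => simpa using hg
  | succ n ih => rw [pow_succ', mul_assoc]; exact ih.Ugen_mul hp

theorem Tgen_inv : Tgen⁻¹ = Tgen ^ 3 := by
  rw [inv_eq_iff_mul_eq_one, ← pow_succ', show 3 + 1 = 2 * 2 by rfl, pow_mul, Tgen_sq]; simp

theorem hasBranchForm_of_mem_heckeGroup {p : ℕ} (hp : 3 ≤ p)
    {g : Matrix.SpecialLinearGroup (Fin 2) ℝ} (hg : g ∈ heckeGroup (heckeLambda p)) :
    HasBranchForm p g := by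
  have hS : Sgen (heckeLambda p) = Ugen (heckeLambda p) * Tgen ^ 3 := by
    rw [← Tgen_inv, Ugen, mul_inv_cancel_right]
  have hU : (Ugen (heckeLambda p))⁻¹ = Tgen ^ 2 * Ugen (heckeLambda p) ^ (p - 1) := by
    rw [Tgen_sq, inv_eq_iff_mul_eq_one, neg_one_mul, mul_neg, ← pow_succ',
      Nat.sub_add_cancel (by omega), Ugen_pow_self hp, neg_neg]
  induction hg using Subgroup.closure_induction_left with
  | one => exact ⟨1, one_mem _, 0, 0, by simp⟩
  | mul_left x hx y _ ih =>
    rcases hx with rfl | rfl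
    · rw [hS, mul_assoc]; exact (ih.Tgen_pow_mul 3).Ugen_mul hp
    · simpa using ih.Tgen_pow_mul 1
  | inv_mul_cancel x hx y _ ih =>
    rcases hx with rfl | rfl
    · rw [hS, ← Tgen_inv, _root_.mul_inv_rev, inv_inv, hU, mul_assoc, mul_assoc]
      simpa using ((ih.Ugen_pow_mul hp (p - 1)).Tgen_pow_mul 2).Tgen_pow_mul 1
    · rw [Tgen_inv]; exact ih.Tgen_pow_mul 3

theorem exists_sign_Tgen_pow (a : ℕ) :
    ∃ e : Matrix.SpecialLinearGroup (Fin 2) ℝ, (e = 1 ∨ e = -1) ∧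
      (Tgen ^ a = e ∨ Tgen ^ a = e * Tgen) := by
  obtain ⟨k, rfl | rfl⟩ := Nat.even_or_odd' a
  · exact ⟨(-1) ^ k, neg_one_pow_eq_or _ k, Or.inl (by rw [pow_mul, Tgen_sq])⟩
  · exact ⟨(-1) ^ k, neg_one_pow_eq_or _ k, Or.inr (by rw [pow_succ, pow_mul, Tgen_sq])⟩

theorem cases_of_mem_heckeGroup {p : ℕ} (hp : 3 ≤ p)
    {g : Matrix.SpecialLinearGroup (Fin 2) ℝ} (hg : g ∈ heckeGroup (heckeLambda p)) :
    ∃ w ∈ branchMonoid p, ∃ h, (g = h ∨ g = -h) ∧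
      (h = w ∨ h = w⁻¹ ∨ h = Tgen * w ∨ h = w * Tgen) := by
  obtain ⟨w, hw, a, b, rfl⟩ := hasBranchForm_of_mem_heckeGroup hp hg
  obtain ⟨e, he, ha⟩ := exists_sign_Tgen_pow a
  obtain ⟨f, hf, hb⟩ := exists_sign_Tgen_pow b
  have sgn : ∀ h : Matrix.SpecialLinearGroup (Fin 2) ℝ, e * h * f = h ∨ e * h * f = -h := by
    intro h
    rcases he with rfl | rfl <;> rcases hf with rfl | rfl <;> simp
  have hcomm : ∀ h, f * h = h * f := by
    intro h
    rcases hf with rfl | rfl <;> simp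
  rcases ha with ha | ha <;> rcases hb with hb | hb <;> rw [ha, hb]
  · exact ⟨w, hw, w, sgn w, by simp⟩
  · refine ⟨w, hw, w * Tgen, ?_, by simp⟩
    have := sgn (w * Tgen)
    rwa [hcomm, show e * w * (Tgen * f) = e * (w * Tgen) * f by group]
  · refine ⟨w, hw, Tgen * w, ?_, by simp⟩
    have := sgn (Tgen * w)
    rwa [show e * Tgen * w * f = e * (Tgen * w) * f by group]
  · obtain ⟨v, hv, hwv⟩ := exists_conj_Tgen hp hw
    refine ⟨v, hv, v⁻¹, ?_, by simp⟩
    have hT : Tgen = -Tgen⁻¹ := by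
      rw [← neg_eq_iff_eq_neg, eq_comm, inv_eq_iff_mul_eq_one, mul_neg, ← sq, Tgen_sq, neg_neg]
    have h2 : e * Tgen * w * (f * Tgen) = -(e * v⁻¹ * f) := by
      rw [hcomm, ← hwv]
      nth_rewrite 2 [hT]
      simp only [mul_assoc, mul_neg, neg_mul]
    rw [h2, neg_inj, neg_eq_iff_eq_neg]
    exact (sgn v⁻¹).symm

theorem Uorbit_sub {p i : ℕ} (hp : 3 ≤ p) (hi : i ≤ p) :
    Uorbit (heckeLambda p) (p - i) = sinRatio p i / sinRatio p (i + 1) := by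
  rw [Uorbit, Umat_pow hp]
  have : (p : ℝ) - i - 1 = p - (i + 1) := by ring
  simp [Nat.cast_sub hi, sinRatio_sub hp, this, neg_div_neg_eq]

theorem sinRatio_div_le_succ {p i : ℕ} (hp : 3 ≤ p) (h1 : 1 ≤ i) (h2 : i + 1 < p) :
    sinRatio p (i - 1) / sinRatio p i ≤ sinRatio p i / sinRatio p (i + 1) := by
  have h1' : (1 : ℝ) ≤ i := by exact_mod_cast h1
  have h2' : (i : ℝ) + 1 + 1 ≤ p := by exact_mod_cast h2
  have hB := one_le_sinRatio hp h1' (by linarith)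
  have hC := one_le_sinRatio hp (x := i + 1) (by linarith) h2'
  rw [div_le_div_iff₀ (by linarith) (by linarith)]
  nlinarith [sinRatio_sq hp i]

theorem sinRatio_div_mono {p a b : ℕ} (hp : 3 ≤ p) (h1 : 1 ≤ a) (hab : a ≤ b) (h2 : b < p) :
    sinRatio p (a - 1) / sinRatio p a ≤ sinRatio p (b - 1) / sinRatio p b := by
  induction b, hab using Nat.le_induction with
  | base => exact le_rfl
  | succ b hab ih =>
    refine (ih (by omega)).trans ?_
    have := sinRatio_div_le_succ hp (h1.trans hab) h2
    push_cast
    rwa [add_sub_cancel_right]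

/-- `g` sends the point `x` to the point `y` as a linear fractional transformation. -/
def MoebiusRel (g : Matrix.SpecialLinearGroup (Fin 2) ℝ) (x y : ℝ) : Prop :=
  g.1 0 0 * x + g.1 0 1 = (g.1 1 0 * x + g.1 1 1) * y

theorem det_entries (g : Matrix.SpecialLinearGroup (Fin 2) ℝ) :
    g.1 0 0 * g.1 1 1 - g.1 0 1 * g.1 1 0 = 1 := by
  rw [← Matrix.det_fin_two]; exact g.2

namespace MoebiusRel

variable {g h : Matrix.SpecialLinearGroup (Fin 2) ℝ} {x y z : ℝ}

theorem denom_ne_zero (hg : MoebiusRel g x y) : g.1 1 0 * x + g.1 1 1 ≠ 0 := by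
  intro h0
  have hg' : g.1 0 0 * x + g.1 0 1 = 0 := by rw [hg, h0, zero_mul]
  have : (1 : ℝ) = 0 := by
    linear_combination -det_entries g + g.1 0 0 * h0 - g.1 1 0 * hg'
  exact one_ne_zero this

theorem mul (hh : MoebiusRel h y z) (hg : MoebiusRel g x y) : MoebiusRel (h * g) x z := by
  simp only [MoebiusRel, Matrix.SpecialLinearGroup.coe_mul, Matrix.mul_apply,
    Fin.sum_univ_two] at *
  linear_combination (g.1 1 0 * x + g.1 1 1) * hh + (h.1 0 0 - h.1 1 0 * z) * hg

theorem inv (hg : MoebiusRel g x y) : MoebiusRel g⁻¹ y x := by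
  simp only [MoebiusRel, Matrix.SpecialLinearGroup.coe_inv, Matrix.adjugate_fin_two] at *
  simp
  linear_combination -hg

theorem of_mul (hhg : MoebiusRel (h * g) x z) (hg : MoebiusRel g x y) : MoebiusRel h y z := by
  simpa using hhg.mul hg.inv

theorem of_neg (hg : MoebiusRel (-g) x y) : MoebiusRel g x y := by
  simp only [MoebiusRel, Matrix.SpecialLinearGroup.coe_neg, Matrix.neg_apply] at *
  linear_combination -hg

theorem of_eq_or_eq_neg (hgh : g = h ∨ g = -h) (hg : MoebiusRel g x y) : MoebiusRel h x y := by
  rcases hgh with rfl | rfl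
  · exact hg
  · exact hg.of_neg

theorem pow (hg : MoebiusRel g x x) (n : ℕ) : MoebiusRel (g ^ n) x x := by
  induction n with
  | zero => simp [MoebiusRel]
  | succ n ih => rw [pow_succ]; exact ih.mul hg

end MoebiusRel

theorem moebiusRel_iff {g : Matrix.SpecialLinearGroup (Fin 2) ℝ} {x y : ℝ} :
    (g.1 1 0 * x + g.1 1 1 ≠ 0 ∧ mobius g.1 x = y) ↔ MoebiusRel g x y := by
  constructor
  · rintro ⟨h0, h⟩
    rw [mobius, div_eq_iff h0] at h
    rw [MoebiusRel, h, mul_comm]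
  · intro h
    refine ⟨h.denom_ne_zero, ?_⟩
    rw [mobius, div_eq_iff h.denom_ne_zero, h, mul_comm]

theorem fixesQuad_iff {g : Matrix.SpecialLinearGroup (Fin 2) ℝ} {x : ℝ} :
    fixesQuad g x ↔ MoebiusRel g x x := by
  rw [fixesQuad, MoebiusRel]
  constructor <;> intro h <;> linear_combination -h

theorem exists_pos_moebiusRel {p : ℕ} (hp : 3 ≤ p) {w : Matrix.SpecialLinearGroup (Fin 2) ℝ}
    (hw : w ∈ branchMonoid p) {y : ℝ} (hy : 0 < y) : ∃ x, 0 < x ∧ MoebiusRel w y x := by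
  obtain ⟨a, b, c, d⟩ := entries_of_mem_branchMonoid hp hw
  have hn : 0 < w.1 0 0 * y + w.1 0 1 := by positivity
  have hd : 0 < w.1 1 0 * y + w.1 1 1 := by positivity
  exact ⟨_, div_pos hn hd, moebiusRel_iff.1 ⟨hd.ne', rfl⟩⟩

theorem exists_neg_moebiusRel {p : ℕ} (hp : 3 ≤ p) {w : Matrix.SpecialLinearGroup (Fin 2) ℝ}
    (hw : w ∈ branchMonoid p) {x : ℝ} (hx : x < 0) : ∃ y, y < 0 ∧ MoebiusRel w y x := by
  obtain ⟨a, b, c, d⟩ := entries_of_mem_branchMonoid hp hw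
  have hn : w.1 1 1 * x - w.1 0 1 < 0 := by nlinarith
  have hd : 0 < w.1 0 0 - w.1 1 0 * x := by nlinarith
  refine ⟨_, div_neg_of_neg_of_pos hn hd, ?_⟩
  rw [MoebiusRel]
  linear_combination div_mul_cancel₀ (w.1 1 1 * x - w.1 0 1) hd.ne'

theorem Phi_eq_of_moebiusRel_branchInv {p i : ℕ} (hp : 3 ≤ p) (h1 : 1 ≤ i) (h2 : i < p)
    {x y : ℝ} (hy : 0 < y) (h : MoebiusRel (branchInv p i) y x) :
    Phi p (heckeLambda p) x = y := by
  have h1' : (1 : ℝ) ≤ i := by exact_mod_cast h1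
  have h2' : (i : ℝ) + 1 ≤ p := by exact_mod_cast h2
  have hB := one_le_sinRatio hp h1' h2'
  have hA := sinRatio_nonneg hp (x := i - 1) (by linarith) (by linarith)
  have hC := sinRatio_nonneg hp (x := i + 1) (by linarith) h2'
  have hdet := sinRatio_sq hp i
  have hden : 0 < sinRatio p (i + 1) * y + sinRatio p i := by positivity
  have hrel : sinRatio p i * y + sinRatio p (i - 1) =
      (sinRatio p (i + 1) * y + sinRatio p i) * x := by
    simpa [MoebiusRel, coe_branchInv hp] using h
  have hlow : sinRatio p (i - 1) / sinRatio p i ≤ x := by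
    rw [div_le_iff₀ (by linarith)]
    refine le_of_mul_le_mul_left ?_ hden
    nlinarith
  have hup : sinRatio p (i + 1) * x < sinRatio p i := by
    refine lt_of_mul_lt_mul_left ?_ hden.le
    nlinarith
  have hleft : ∀ j : ℕ, 1 ≤ j → j ≤ p - 2 → Uorbit (heckeLambda p) (p - j + 1) =
      sinRatio p (j - 1) / sinRatio p j := by
    intro j hj hj2
    rw [show p - j + 1 = p - (j - 1) by omega, Uorbit_sub hp (by omega), Nat.cast_sub hj]
    simp
  have huniq : ∀ j : ℕ, 1 ≤ j → j ≤ p - 2 → Uorbit (heckeLambda p) (p - j + 1) ≤ x →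
      x < Uorbit (heckeLambda p) (p - j) → j = i := by
    intro j hj1 hj2 hjl hju
    rw [hleft j hj1 hj2] at hjl
    rw [Uorbit_sub hp (by omega)] at hju
    rcases lt_trichotomy j i with hlt | heq | hgt
    · have := sinRatio_div_mono hp (a := j + 1) (b := i) (by omega) hlt h2
      push_cast at this
      rw [add_sub_cancel_right] at this
      linarith
    · exact heq
    · have := sinRatio_div_mono hp (a := i + 1) (b := j) (by omega) hgt (by omega)
      push_cast at this
      rw [add_sub_cancel_right] at this
      have hC1 := one_le_sinRatio hp (x := i + 1) (by linarith)
        (by exact_mod_cast (by omega : i + 1 + 1 ≤ p))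
      have hx : x < sinRatio p i / sinRatio p (i + 1) := by
        rw [lt_div_iff₀ (by linarith), mul_comm]; exact hup
      linarith
  by_cases hi : i ≤ p - 2
  · have hex : ∃ j : ℕ, 1 ≤ j ∧ j ≤ p - 2 ∧ Uorbit (heckeLambda p) (p - j + 1) ≤ x ∧
        x < Uorbit (heckeLambda p) (p - j) := by
      refine ⟨i, h1, hi, ?_, ?_⟩
      · rwa [hleft i h1 hi]
      · have hC1 := one_le_sinRatio hp (x := i + 1) (by linarith)
          (by exact_mod_cast (by omega : i + 1 + 1 ≤ p))
        rw [Uorbit_sub hp (by omega), lt_div_iff₀ (by linarith), mul_comm]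
        exact hup
    have hch : hex.choose = i := by
      obtain ⟨c1, c2, c3, c4⟩ := hex.choose_spec
      exact huniq _ c1 c2 c3 c4
    rw [Phi, dif_pos hex, hch, Umat_pow hp, mobius]
    simp only [Tmat, Matrix.mul_apply, Fin.sum_univ_two]
    simp
    rw [div_eq_iff (by linarith)]
    linear_combination hrel
  · have hip : i + 1 = p := by omega
    rw [Phi, dif_neg]
    · have e1 : sinRatio p ((i : ℝ) + 1) = 0 := by
        rw [show (i : ℝ) + 1 = p by exact_mod_cast hip, sinRatio_self hp]
      have hi' : (i : ℝ) = p - 1 := by rw [← hip]; push_cast; ring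
      have e2 : sinRatio p (i : ℝ) = 1 := by rw [hi', sinRatio_sub hp, sinRatio_one hp]
      have e3 : sinRatio p ((i : ℝ) - 1) = heckeLambda p := by
        rw [hi', sub_sub, one_add_one_eq_two, sinRatio_sub hp, sinRatio_two hp]
      rw [e1, e2, e3] at hrel
      linarith
    · rintro ⟨j, c1, c2, c3, c4⟩
      have := huniq j c1 c2 c3 c4
      omega

theorem exists_Phi_iterate_eq {p : ℕ} (hp : 3 ≤ p) {w : Matrix.SpecialLinearGroup (Fin 2) ℝ}
    (hw : w ∈ branchMonoid p) :
    ∃ m, (m = 0 → w = 1) ∧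
      ∀ x y, 0 < y → MoebiusRel w y x → (Phi p (heckeLambda p))^[m] x = y := by
  induction hw using Submonoid.closure_induction with
  | mem g hg =>
    obtain ⟨i, h1, h2, rfl⟩ := hg
    exact ⟨1, by simp, fun x y hy h => Phi_eq_of_moebiusRel_branchInv hp h1 h2 hy h⟩
  | one => exact ⟨0, fun _ => rfl, fun x y _ h => by simpa [MoebiusRel] using h.symm⟩
  | mul u v hu hv ihu ihv =>
    obtain ⟨m, hm, hm'⟩ := ihu
    obtain ⟨n, hn, hn'⟩ := ihv
    refine ⟨n + m, fun h => ?_, fun x y hy h => ?_⟩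
    · rw [hm (by omega), hn (by omega), one_mul]
    · obtain ⟨z, hz, hvz⟩ := exists_pos_moebiusRel hp hv hy
      rw [Function.iterate_add_apply, hm' x z hz (h.of_mul hvz), hn' z y hy hvz]

theorem exists_branchMonoid_stabilizer {p : ℕ} (hp : 3 ≤ p) {α α' : ℝ}
    (hpair : IsHypPair (heckeLambda p) α α') (hneg : α' < 0) (hpos : 0 < α) :
    ∃ M ∈ branchMonoid p, 2 < M.1 0 0 + M.1 1 1 ∧ MoebiusRel M α α ∧ MoebiusRel M α' α' := by
  obtain ⟨M, hM, htr, hα, hα', -⟩ := hpair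
  rw [fixesQuad_iff] at hα hα'
  obtain ⟨w, hw, h, hMh, hcases⟩ := cases_of_mem_heckeGroup hp hM
  replace hα := hα.of_eq_or_eq_neg hMh
  replace hα' := hα'.of_eq_or_eq_neg hMh
  obtain ⟨a, b, c, d⟩ := entries_of_mem_branchMonoid hp hw
  have htr' : 2 < |h.1 0 0 + h.1 1 1| := by
    rcases hMh with rfl | rfl
    · exact htr
    · simpa only [Matrix.SpecialLinearGroup.coe_neg, Matrix.neg_apply, ← neg_add, abs_neg]
        using htr
  rcases hcases with rfl | rfl | rfl | rfl
  · exact ⟨h, hw, by rwa [abs_of_pos (by linarith)] at htr', hα, hα'⟩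
  · refine ⟨w, hw, ?_, by simpa using hα.inv, by simpa using hα'.inv⟩
    rw [Matrix.SpecialLinearGroup.coe_inv, Matrix.adjugate_fin_two] at htr'
    simp only [Matrix.of_apply, Matrix.cons_val', Matrix.cons_val_zero, Matrix.cons_val_one,
      Matrix.cons_val_fin_one] at htr'
    rw [abs_of_pos (by linarith)] at htr'
    linarith
  · exfalso
    simp only [MoebiusRel, Matrix.SpecialLinearGroup.coe_mul, Matrix.mul_apply,
      Fin.sum_univ_two] at hα
    simp [Tgen] at hα
    nlinarith [mul_nonneg b hpos.le, mul_nonneg c hpos.le, mul_pos hpos hpos]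
  · exfalso
    simp only [MoebiusRel, Matrix.SpecialLinearGroup.coe_mul, Matrix.mul_apply,
      Fin.sum_univ_two] at hα'
    simp [Tgen] at hα'
    nlinarith [mul_nonneg b (neg_pos.2 hneg).le, mul_nonneg c (neg_pos.2 hneg).le,
      mul_pos_of_neg_of_neg hneg hneg]

theorem ne_one_of_two_lt_trace {M : Matrix.SpecialLinearGroup (Fin 2) ℝ}
    (h : 2 < M.1 0 0 + M.1 1 1) : M ≠ 1 := by
  rintro rfl
  simp at h
  norm_num at h

theorem exists_Phi_period {p : ℕ} (hp : 3 ≤ p) {α α' : ℝ}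
    (hpair : IsHypPair (heckeLambda p) α α') (hneg : α' < 0) (hpos : 0 < α) :
    ∃ N : ℕ, 1 ≤ N ∧ (Phi p (heckeLambda p))^[N] α = α := by
  obtain ⟨M, hM, htr, hα, -⟩ := exists_branchMonoid_stabilizer hp hpair hneg hpos
  obtain ⟨m, hm, hm'⟩ := exists_Phi_iterate_eq hp hM
  exact ⟨m, Nat.one_le_iff_ne_zero.2 fun h => ne_one_of_two_lt_trace htr (hm h),
    hm' α α hpos hα⟩

theorem exists_hypPair_Phi {p : ℕ} (hp : 3 ≤ p) {α α' : ℝ}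
    (hpair : IsHypPair (heckeLambda p) α α') (hneg : α' < 0) (hpos : 0 < α) :
    (∃ β', IsHypPair (heckeLambda p) (Phi p (heckeLambda p) α) β' ∧ β' < 0 ∧
      0 < Phi p (heckeLambda p) α) ∧
    ∃ V ∈ heckeGroup (heckeLambda p), MoebiusRel V α (Phi p (heckeLambda p) α) := by
  obtain ⟨M, hM, htr, hα, hα'⟩ := exists_branchMonoid_stabilizer hp hpair hneg hpos
  rcases eq_one_or_branchInv_mul hM with rfl | ⟨i, h1, h2, v, hv, rfl⟩
  · exact absurd rfl (ne_one_of_two_lt_trace htr)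
  have hi := branchInv_mem h1 h2
  obtain ⟨β, hβ, hvβ⟩ := exists_pos_moebiusRel hp hv hpos
  obtain ⟨β', hβ', hiβ'⟩ := exists_neg_moebiusRel hp hi hneg
  have hiβ := hα.of_mul hvβ
  have hvβ' : MoebiusRel v α' β' := by simpa using hiβ'.inv.mul hα'
  rw [Phi_eq_of_moebiusRel_branchInv hp h1 h2 hβ hiβ]
  refine ⟨⟨β', ⟨v * branchInv p i, branchMonoid_le (mul_mem hv hi), ?_,
    fixesQuad_iff.2 (hvβ.mul hiβ), fixesQuad_iff.2 (hvβ'.mul hiβ'), by linarith⟩, hβ', hβ⟩,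
    (branchInv p i)⁻¹, inv_mem (branchMonoid_le hi), hiβ.inv⟩
  have : 0 ≤ (branchInv p i * v).1 0 0 + (branchInv p i * v).1 1 1 := by linarith
  rw [← abs_of_nonneg this] at htr
  convert htr using 2
  simp only [Matrix.SpecialLinearGroup.coe_mul, Matrix.mul_apply, Fin.sum_univ_two]
  ring

theorem le_trace_pow {p : ℕ} (hp : 3 ≤ p) {N : Matrix.SpecialLinearGroup (Fin 2) ℝ}
    (hN : N ∈ branchMonoid p) (n : ℕ) :
    n * (N.1 0 0 - 1) ≤ (N ^ n).1 0 0 - 1 ∧ n * (N.1 1 1 - 1) ≤ (N ^ n).1 1 1 - 1 := by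
  induction n with
  | zero => simp
  | succ n ih =>
    obtain ⟨a, b, c, d⟩ := entries_of_mem_branchMonoid hp hN
    obtain ⟨a', b', c', d'⟩ := entries_of_mem_branchMonoid hp (pow_mem hN n)
    rw [pow_succ, Matrix.SpecialLinearGroup.coe_mul]
    simp only [Matrix.mul_apply, Fin.sum_univ_two]
    push_cast
    constructor
    · nlinarith [mul_nonneg b' c, mul_nonneg (sub_nonneg.2 a) (sub_nonneg.2 a')]
    · nlinarith [mul_nonneg c' b, mul_nonneg (sub_nonneg.2 d) (sub_nonneg.2 d')]

theorem exists_not_mul_Tgen {p : ℕ} (hp : 3 ≤ p) {M V : Matrix.SpecialLinearGroup (Fin 2) ℝ}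
    (hM : M ∈ branchMonoid p) (htr : 2 < M.1 0 0 + M.1 1 1) :
    ∃ n : ℕ, ∀ w ∈ branchMonoid p, V * M ^ n ≠ w * Tgen ∧ V * M ^ n ≠ -(w * Tgen) := by
  obtain ⟨N, hN, hMN⟩ := exists_conj_Tgen hp hM
  have hN' : N = Tgen * M⁻¹ * Tgen⁻¹ := by
    rw [← _root_.inv_inj, ← hMN]; group
  have htrN : N.1 0 0 + N.1 1 1 = M.1 0 0 + M.1 1 1 := by
    have hT : Tgen⁻¹ = -Tgen := by
      rw [inv_eq_iff_mul_eq_one, mul_neg, ← sq, Tgen_sq, neg_neg]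
    rw [hN', hT]
    simp only [Matrix.SpecialLinearGroup.coe_mul, Matrix.SpecialLinearGroup.coe_neg,
      Matrix.SpecialLinearGroup.coe_inv, Matrix.mul_apply, Fin.sum_univ_two,
      Matrix.adjugate_fin_two]
    simp [Tgen]
  set K := V * Tgen⁻¹ with hK
  obtain ⟨n, hn⟩ := exists_nat_gt ((|K.1 0 0| + |K.1 1 1|) / (M.1 0 0 + M.1 1 1 - 2))
  rw [div_lt_iff₀ (by linarith)] at hn
  refine ⟨n, fun w hw => ?_⟩
  obtain ⟨a, b, c, d⟩ := entries_of_mem_branchMonoid hp hw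
  obtain ⟨a', b', c', d'⟩ := entries_of_mem_branchMonoid hp (pow_mem hN n)
  obtain ⟨t1, t2⟩ := le_trace_pow hp hN n
  have hbig : |K.1 0 0| + |K.1 1 1| < (w * N ^ n).1 0 0 + (w * N ^ n).1 1 1 := by
    simp only [Matrix.SpecialLinearGroup.coe_mul, Matrix.mul_apply, Fin.sum_univ_two]
    nlinarith [mul_nonneg b c', mul_nonneg c b']
  have hconj : N ^ n = Tgen * (M ^ n)⁻¹ * Tgen⁻¹ := by
    rw [hN', conj_pow, inv_pow]
  have key : ∀ u, V * M ^ n = u * Tgen → K = u * N ^ n := by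
    intro u hu
    rw [hconj, hK, eq_mul_inv_of_mul_eq hu]
    group
  constructor <;> intro h
  · have := key w h
    rw [← this] at hbig
    linarith [le_abs_self (K.1 0 0), le_abs_self (K.1 1 1)]
  · have := key (-w) (by rw [h, neg_mul])
    rw [this] at hbig
    rw [neg_mul] at hbig
    simp only [Matrix.SpecialLinearGroup.coe_neg, Matrix.neg_apply, abs_neg] at hbig
    linarith [le_abs_self ((w * N ^ n).1 0 0), le_abs_self ((w * N ^ n).1 1 1)]

theorem iterate_of_iterate_eq {f : ℝ → ℝ} {x y : ℝ} {m N : ℕ} (hN : 1 ≤ N)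
    (hper : f^[N] x = x) (h : f^[m] x = y) : ∃ k, f^[k] y = x := by
  refine ⟨N * m - m, ?_⟩
  rw [← h, ← Function.iterate_add_apply, Nat.sub_add_cancel (Nat.le_mul_of_pos_left m hN)]
  exact Function.IsPeriodicPt.mul_const (show Function.IsPeriodicPt f N x from hper) m

theorem exists_iterate_of_moebiusRel {p : ℕ} (hp : 3 ≤ p) {α α' γ γ' : ℝ}
    (hα : IsHypPair (heckeLambda p) α α') (hα0 : α' < 0) (hα1 : 0 < α)
    (hγ : IsHypPair (heckeLambda p) γ γ') (hγ0 : γ' < 0) (hγ1 : 0 < γ)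
    {V : Matrix.SpecialLinearGroup (Fin 2) ℝ} (hV : V ∈ heckeGroup (heckeLambda p))
    (hVα : MoebiusRel V α γ) : ∃ n : ℕ, (Phi p (heckeLambda p))^[n] α = γ := by
  obtain ⟨M, hM, htr, hMα, -⟩ := exists_branchMonoid_stabilizer hp hα hα0 hα1
  obtain ⟨n, hn⟩ := exists_not_mul_Tgen hp (V := V) hM htr
  have hVM : V * M ^ n ∈ heckeGroup (heckeLambda p) :=
    Subgroup.mul_mem _ hV (branchMonoid_le (pow_mem hM n))
  obtain ⟨w, hw, h, hgh, hcases⟩ := cases_of_mem_heckeGroup hp hVM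
  have hrel := (hVα.mul (hMα.pow n)).of_eq_or_eq_neg hgh
  rcases hcases with rfl | rfl | rfl | rfl
  · obtain ⟨m, -, hm⟩ := exists_Phi_iterate_eq hp hw
    obtain ⟨N, hN, hper⟩ := exists_Phi_period hp hγ hγ0 hγ1
    exact iterate_of_iterate_eq hN hper (hm γ α hα1 hrel)
  · obtain ⟨m, -, hm⟩ := exists_Phi_iterate_eq hp hw
    exact ⟨m, hm α γ hγ1 (by simpa using hrel.inv)⟩
  · exfalso
    obtain ⟨z, hz, hwz⟩ := exists_pos_moebiusRel hp hw hα1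
    have := hrel.of_mul hwz
    simp [MoebiusRel, Tgen] at this
    nlinarith [mul_pos hz hγ1]
  · exact absurd hgh (not_or.2 (hn w hw))

theorem Phi_iterate_simple {p : ℕ} (hp : 3 ≤ p) {α α' : ℝ}
    (hpair : IsHypPair (heckeLambda p) α α') (hneg : α' < 0) (hpos : 0 < α) (n : ℕ) :
    (∃ β', IsHypPair (heckeLambda p) ((Phi p (heckeLambda p))^[n] α) β' ∧ β' < 0 ∧
      0 < (Phi p (heckeLambda p))^[n] α) ∧
    ∃ V ∈ heckeGroup (heckeLambda p), MoebiusRel V α ((Phi p (heckeLambda p))^[n] α) := by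
  induction n with
  | zero => exact ⟨⟨α', hpair, hneg, hpos⟩, 1, one_mem _, by simp [MoebiusRel]⟩
  | succ n ih =>
    obtain ⟨⟨β', h1, h2, h3⟩, V, hV, hVα⟩ := ih
    obtain ⟨hsimple, W, hW, hWβ⟩ := exists_hypPair_Phi hp h1 h2 h3
    rw [Function.iterate_succ_apply']
    exact ⟨hsimple, W * V, Subgroup.mul_mem _ hW hV, hWβ.mul hVα⟩

/-- if `α` is a `G_p`-simple number, then its forward orbit under
`Φ_p` is finite, is permuted cyclically by `Φ_p`, and consists exactly of all
`G_p`-simple numbers `G_p`-equivalent to `α`. -/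
theorem hecke_simple_orbit (p : ℕ) (hp : 3 ≤ p) (α α' : ℝ)
    (hpair : IsHypPair (heckeLambda p) α α') (hneg : α' < 0) (hpos : 0 < α) :
    {y : ℝ | ∃ n : ℕ, (Phi p (heckeLambda p))^[n] α = y}.Finite ∧
    (∃ N : ℕ, 1 ≤ N ∧ (Phi p (heckeLambda p))^[N] α = α) ∧
    {y : ℝ | ∃ n : ℕ, (Phi p (heckeLambda p))^[n] α = y} =
      {γ : ℝ | (∃ γ' : ℝ, IsHypPair (heckeLambda p) γ γ' ∧ γ' < 0 ∧ 0 < γ) ∧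
        ∃ V ∈ heckeGroup (heckeLambda p),
          V.1 1 0 * α + V.1 1 1 ≠ 0 ∧ mobius V.1 α = γ} := by
  obtain ⟨N, hN, hper⟩ := exists_Phi_period hp hpair hneg hpos
  refine ⟨?_, ⟨N, hN, hper⟩, ?_⟩
  · refine ((Set.finite_Iio N).image fun n => (Phi p (heckeLambda p))^[n] α).subset ?_
    rintro y ⟨n, rfl⟩
    exact ⟨n % N, Nat.mod_lt _ hN, Function.IsPeriodicPt.iterate_mod_apply hper n⟩
  · ext γ
    constructor
    · rintro ⟨n, rfl⟩
      obtain ⟨hsimple, V, hV, hVα⟩ := Phi_iterate_simple hp hpair hneg hpos n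
      exact ⟨hsimple, V, hV, moebiusRel_iff.2 hVα⟩
    · rintro ⟨⟨γ', h1, h2, h3⟩, V, hV, hVα⟩
      exact exists_iterate_of_moebiusRel hp hpair hneg hpos h1 h2 h3 hV (moebiusRel_iff.1 hVα)
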